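/- arXiv:2001.08881 — 3 statements merged into one kernel-verified Lean document; each statement's English description precedes it below -/
import Mathlib

section
/- If G is a finite simple graph with independence number α(G) ≤ 3, then G has no purely imaginary independence roots; that is, no complex root z of I(G,x) satisfies Re(z) = 0 and z ≠ 0. -/
open scoped Classical
open Polynomial

/-- `s` is an independent set of the simple graph `G`. -/
def SimpleGraph.IsIndepFinset {V : Type} (G : SimpleGraph V) (s : Finset V) : Prop :=
  ∀ u ∈ s, ∀ v ∈ s, ¬ G.Adj u v

/-- The independence polynomial of `G`, as a polynomial over `ℂ`:
`I(G,x) = ∑_k s_k x^k` where `s_k` is the number of independent sets of cardinality `k`. -/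
noncomputable def indepPoly {V : Type} [Fintype V] (G : SimpleGraph V) : Polynomial ℂ :=
  ∑ s ∈ Finset.univ.filter (fun s : Finset V => G.IsIndepFinset s), (X : Polynomial ℂ) ^ s.card

/-- The independence number of `G`. -/
noncomputable def indepNum {V : Type} [Fintype V] (G : SimpleGraph V) : ℕ :=
  (Finset.univ.filter (fun s : Finset V => G.IsIndepFinset s)).sup Finset.card

/-- The join `G + H` of two graphs: their disjoint union together with
all edges between the two parts. -/
def graphJoin {α β : Type} (G : SimpleGraph α) (H : SimpleGraph β) : SimpleGraph (α ⊕ β) where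
  Adj x y :=
    match x, y with
    | Sum.inl a, Sum.inl b => G.Adj a b
    | Sum.inr a, Sum.inr b => H.Adj a b
    | Sum.inl _, Sum.inr _ => True
    | Sum.inr _, Sum.inl _ => True
  symm := by
    constructor
    rintro (a | a) (b | b) h
    · exact G.adj_symm h
    · trivial
    · trivial
    · exact H.adj_symm h
  loopless := by
    constructor
    rintro (a | a) h
    · exact G.loopless.irrefl a h
    · exact H.loopless.irrefl a h

/-- `mK_n` : the disjoint union of `m` copies of the complete graph `K_n`. -/
def mClique (m n : ℕ) : SimpleGraph (Fin m × Fin n) where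
  Adj x y := x.1 = y.1 ∧ x ≠ y
  symm := by constructor; rintro x y ⟨h1, h2⟩; exact ⟨h1.symm, h2.symm⟩
  loopless := by constructor; rintro x ⟨_, h⟩; exact h rfl

/-- The lexicographic product `G[H]`. -/
def lexProd {α β : Type} (G : SimpleGraph α) (H : SimpleGraph β) : SimpleGraph (α × β) where
  Adj x y := G.Adj x.1 y.1 ∨ (x.1 = y.1 ∧ H.Adj x.2 y.2)
  symm := by
    constructor
    rintro x y (h | ⟨h1, h2⟩)
    · exact Or.inl (G.adj_symm h)
    · exact Or.inr ⟨h1.symm, H.adj_symm h2⟩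
  loopless := by
    constructor
    rintro x (h | ⟨-, h⟩)
    · exact G.loopless.irrefl _ h
    · exact H.loopless.irrefl _ h

/-- The corona `G ∘ H`: for each vertex `v` of `G`, add a new copy of `H`
joined completely to `v`. -/
def corona {α β : Type} (G : SimpleGraph α) (H : SimpleGraph β) : SimpleGraph (α ⊕ α × β) where
  Adj x y :=
    match x, y with
    | Sum.inl a, Sum.inl b => G.Adj a b
    | Sum.inl a, Sum.inr b => a = b.1
    | Sum.inr a, Sum.inl b => b = a.1
    | Sum.inr a, Sum.inr b => a.1 = b.1 ∧ H.Adj a.2 b.2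
  symm := by
    constructor
    rintro (a | a) (b | b) h
    · exact G.adj_symm h
    · exact h
    · exact h
    · exact ⟨h.1.symm, H.adj_symm h.2⟩
  loopless := by
    constructor
    rintro (a | a) h
    · exact G.loopless.irrefl a h
    · exact H.loopless.irrefl a.2 h.2

/-- The independent sets of `G` with exactly `k` vertices. -/
noncomputable def indepFinsets {V : Type} [Fintype V] (G : SimpleGraph V) (k : ℕ) :
    Finset (Finset V) :=
  (Finset.univ.filter (fun s : Finset V => G.IsIndepFinset s)).filter (fun s => s.card = k)

theorem mem_indepFinsets {V : Type} [Fintype V] {G : SimpleGraph V} {k : ℕ} {s : Finset V} :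
    s ∈ indepFinsets G k ↔ G.IsIndepFinset s ∧ s.card = k := by
  simp [indepFinsets]

theorem SimpleGraph.IsIndepFinset.subset {V : Type} {G : SimpleGraph V} {s t : Finset V}
    (ht : G.IsIndepFinset t) (hst : s ⊆ t) : G.IsIndepFinset s :=
  fun u hu v hv => ht u (hst hu) v (hst hv)

theorem card_indepFinsets_zero {V : Type} [Fintype V] (G : SimpleGraph V) :
    (indepFinsets G 0).card = 1 := by
  rw [Finset.card_eq_one]
  refine ⟨∅, Finset.ext fun s => ?_⟩
  rw [mem_indepFinsets, Finset.mem_singleton, Finset.card_eq_zero]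
  refine ⟨And.right, ?_⟩
  rintro rfl
  exact ⟨by simp [SimpleGraph.IsIndepFinset], rfl⟩

theorem eval_indepPoly {V : Type} [Fintype V] (G : SimpleGraph V) {n : ℕ}
    (h : indepNum G ≤ n) (z : ℂ) :
    (indepPoly G).eval z = ∑ k ∈ Finset.range (n + 1), ((indepFinsets G k).card : ℂ) * z ^ k := by
  rw [indepPoly, eval_finsetSum, ← Finset.sum_fiberwise_of_maps_to (t := Finset.range (n + 1))
    (g := Finset.card)]
  · refine Finset.sum_congr rfl fun k _ => ?_
    rw [← nsmul_eq_mul, ← Finset.sum_const]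
    refine Finset.sum_congr rfl fun s hs => ?_
    rw [eval_pow, eval_X, (Finset.mem_filter.1 hs).2]
  · intro s hs
    exact Finset.mem_range.2 (Nat.lt_succ_of_le ((Finset.le_sup hs).trans h))

/-- Every independent triple is a disjoint union of an independent singleton and an independent
pair, but not every singleton is disjoint from every pair. -/
theorem card_indepFinsets_three_lt {V : Type} [Fintype V] (G : SimpleGraph V)
    (h : (indepFinsets G 2).Nonempty) :
    (indepFinsets G 3).card < (indepFinsets G 1).card * (indepFinsets G 2).card := by
  set P := indepFinsets G 1 ×ˢ indepFinsets G 2 with hP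
  have hsub : indepFinsets G 3 ⊆
      (P.filter fun q => (q.1 ∪ q.2).card = 3).image fun q => q.1 ∪ q.2 := by
    intro s hs
    obtain ⟨hind, hcard⟩ := mem_indepFinsets.1 hs
    obtain ⟨a, ha⟩ : s.Nonempty := Finset.card_pos.1 (by omega)
    have hunion : {a} ∪ s.erase a = s := by
      rw [← Finset.insert_eq, Finset.insert_erase ha]
    refine Finset.mem_image.2 ⟨({a}, s.erase a), Finset.mem_filter.2 ⟨?_, ?_⟩, hunion⟩
    · refine Finset.mem_product.2 ⟨mem_indepFinsets.2 ⟨?_, Finset.card_singleton a⟩,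
        mem_indepFinsets.2 ⟨hind.subset (Finset.erase_subset a s), ?_⟩⟩
      · exact hind.subset (Finset.singleton_subset_iff.2 ha)
      · rw [Finset.card_erase_of_mem ha, hcard]
    · rw [hunion, hcard]
  rw [← Finset.card_product, ← hP]
  refine ((Finset.card_le_card hsub).trans Finset.card_image_le).trans_lt
    (Finset.card_lt_card (Finset.filter_ssubset.2 ?_))
  obtain ⟨p, hp⟩ := h
  obtain ⟨hind, hcard⟩ := mem_indepFinsets.1 hp
  obtain ⟨a, ha⟩ : p.Nonempty := Finset.card_pos.1 (by omega)
  have hap : {a} ⊆ p := Finset.singleton_subset_iff.2 ha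
  refine ⟨({a}, p), Finset.mem_product.2
    ⟨mem_indepFinsets.2 ⟨hind.subset hap, Finset.card_singleton a⟩, hp⟩, ?_⟩
  rw [Finset.union_eq_right.2 hap, hcard]
  decide

/-- If `α(G) ≤ 3`, then `G` has no purely imaginary independence roots: no root `z` of
`I(G,x)` satisfies `Re(z) = 0` and `z ≠ 0`. -/
theorem no_purely_imaginary_roots_of_indepNum_le_three {V : Type} [Fintype V]
    (G : SimpleGraph V) (h : indepNum G ≤ 3) :
    ¬ ∃ z : ℂ, (indepPoly G).eval z = 0 ∧ z.re = 0 ∧ z ≠ 0 := by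
  rintro ⟨z, hz, hre, hne⟩
  have him : z.im ≠ 0 := fun him => hne (Complex.ext hre him)
  rw [eval_indepPoly G h, Finset.sum_range_succ, Finset.sum_range_succ, Finset.sum_range_succ,
    Finset.sum_range_one, card_indepFinsets_zero] at hz
  have hlt := card_indepFinsets_three_lt G
  rw [← Finset.card_pos] at hlt
  generalize (indepFinsets G 1).card = a at hz hlt
  generalize (indepFinsets G 2).card = b at hz hlt
  generalize (indepFinsets G 3).card = c at hz hlt
  have h_re := congrArg Complex.re hz
  have h_im := congrArg Complex.im hz
  simp [pow_succ, hre] at h_re h_im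
  have hb : (b : ℝ) * z.im ^ 2 = 1 := by linarith
  have hc : (a : ℝ) = c * z.im ^ 2 := mul_right_cancel₀ him (by linarith)
  have hbpos : 0 < b := Nat.pos_of_ne_zero fun hb0 => by simp [hb0] at hb
  have hcab : (a * b : ℝ) = c := by rw [hc, mul_right_comm, mul_assoc, hb, mul_one]
  exact (hlt hbpos).ne (by exact_mod_cast hcab.symm)
end

section
/- Let x_1 = y_1 = 1, x_2 = 5, y_2 = 3, and for n ≥ 3 let x_n = 4x_{n-1} − x_{n-2}, y_n = 4y_{n-1} − y_{n-2}. For each n ≥ 1, set a = 3y_n, b = 3y_n x_n, c = 1, and d = 4a³ − 4a + b³ − 3b − 2. Then a, b, c, d are positive integers and the graph G(a,b,c,d) = 4K_a + 3K_b + 2K_c + K_d has independence roots at i and −i. -/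
open scoped Classical
open Polynomial

/-- The graph `G(a,b,c,d) = 4K_a + 3K_b + 2K_c + K_d`. -/
def Gabcd (a b c d : ℕ) :
    SimpleGraph ((Fin 4 × Fin a) ⊕ ((Fin 3 × Fin b) ⊕ ((Fin 2 × Fin c) ⊕ Fin d))) :=
  graphJoin (mClique 4 a)
    (graphJoin (mClique 3 b) (graphJoin (mClique 2 c) (SimpleGraph.completeGraph (Fin d))))

theorem indepPoly_graphJoin {α β : Type} [Fintype α] [Fintype β]
    (G : SimpleGraph α) (H : SimpleGraph β) :
    indepPoly (graphJoin G H) + 1 = indepPoly G + indepPoly H := by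
  set A := (Finset.univ.filter fun s : Finset α => G.IsIndepFinset s).map
    (Finset.mapEmbedding (Function.Embedding.inl : α ↪ α ⊕ β)).toEmbedding with hA
  set B := (Finset.univ.filter fun s : Finset β => H.IsIndepFinset s).map
    (Finset.mapEmbedding (Function.Embedding.inr : β ↪ α ⊕ β)).toEmbedding with hB
  have hunion : (Finset.univ.filter fun s : Finset (α ⊕ β) => (graphJoin G H).IsIndepFinset s)
      = A ∪ B := by
    ext s
    simp only [hA, hB, Finset.mem_filter, Finset.mem_univ, true_and, Finset.mem_union,
      Finset.mem_map, RelEmbedding.coe_toEmbedding, Finset.mapEmbedding_apply]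
    constructor
    · intro hs
      by_cases hr : ∃ b, Sum.inr b ∈ s
      · obtain ⟨b, hb⟩ := hr
        refine Or.inr ⟨Finset.univ.filter fun v => Sum.inr v ∈ s, ?_, ?_⟩
        · intro u hu v hv
          exact hs _ (Finset.mem_filter.1 hu).2 _ (Finset.mem_filter.1 hv).2
        · ext (v | v)
          · have : Sum.inl v ∉ s := fun hv => hs _ hv _ hb trivial
            simp [this]
          · simp
      · refine Or.inl ⟨Finset.univ.filter fun v => Sum.inl v ∈ s, ?_, ?_⟩
        · intro u hu v hv
          exact hs _ (Finset.mem_filter.1 hu).2 _ (Finset.mem_filter.1 hv).2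
        · ext (v | v)
          · simp
          · have : Sum.inr v ∉ s := fun hv => hr ⟨v, hv⟩
            simp [this]
    · rintro (⟨t, ht, rfl⟩ | ⟨t, ht, rfl⟩) u hu v hv <;>
        obtain ⟨u', hu', rfl⟩ := Finset.mem_map.1 hu <;>
        obtain ⟨v', hv', rfl⟩ := Finset.mem_map.1 hv <;>
        exact ht u' hu' v' hv'
  have hinter : A ∩ B = {∅} := by
    ext s
    simp only [hA, hB, Finset.mem_filter, Finset.mem_univ, true_and, Finset.mem_inter,
      Finset.mem_map, RelEmbedding.coe_toEmbedding, Finset.mapEmbedding_apply,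
      Finset.mem_singleton]
    constructor
    · rintro ⟨⟨t, -, rfl⟩, ⟨u, -, hu⟩⟩
      rw [Finset.eq_empty_iff_forall_notMem]
      intro v hv
      have hv' := hu ▸ hv
      obtain ⟨a, -, rfl⟩ := Finset.mem_map.1 hv
      obtain ⟨b, -, hb⟩ := Finset.mem_map.1 hv'
      exact Sum.inr_ne_inl hb
    · rintro rfl
      exact ⟨⟨∅, by simp [SimpleGraph.IsIndepFinset], by simp⟩,
        ⟨∅, by simp [SimpleGraph.IsIndepFinset], by simp⟩⟩
  have h := Finset.sum_union_inter (s₁ := A) (s₂ := B)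
    (f := fun s : Finset (α ⊕ β) => (X : ℂ[X]) ^ s.card)
  rw [hinter, Finset.sum_singleton, Finset.card_empty, pow_zero] at h
  simpa [indepPoly, hunion, hA, hB] using h

theorem indepPoly_completeGraph (n : ℕ) :
    indepPoly (SimpleGraph.completeGraph (Fin n)) = 1 + (n : ℂ[X]) * X := by
  have h : (Finset.univ.filter fun s : Finset (Fin n) =>
      (SimpleGraph.completeGraph (Fin n)).IsIndepFinset s)
      = insert ∅ (Finset.univ.map ⟨fun i : Fin n => ({i} : Finset (Fin n)),
          Finset.singleton_injective⟩) := by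
    ext s
    simp only [Finset.mem_filter, Finset.mem_univ, true_and, Finset.mem_insert, Finset.mem_map,
      Function.Embedding.coeFn_mk]
    constructor
    · intro hs
      rcases s.eq_empty_or_nonempty with h | ⟨i, hi⟩
      · exact Or.inl h
      · refine Or.inr ⟨i, (Finset.eq_singleton_iff_unique_mem.2 ⟨hi, fun j hj => ?_⟩).symm⟩
        by_contra hne
        exact hs j hj i hi hne
    · rintro (rfl | ⟨i, rfl⟩) <;> simp [SimpleGraph.IsIndepFinset]
  rw [indepPoly, h, Finset.sum_insert (by simp)]
  simp

theorem indepPoly_mClique (m n : ℕ) :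
    indepPoly (mClique m n) = (1 + (n : ℂ[X]) * X) ^ m := by
  have hsum : ∑ o : Option (Fin n), (X : ℂ[X]) ^ o.toFinset.card = 1 + (n : ℂ[X]) * X := by
    simp [Fintype.sum_option]
  have hprod : (1 + (n : ℂ[X]) * X) ^ m
      = ∑ f : Fin m → Option (Fin n), ∏ i, (X : ℂ[X]) ^ (f i).toFinset.card := by
    rw [← Fintype.prod_sum (fun (_ : Fin m) (o : Option (Fin n)) => (X : ℂ[X]) ^ o.toFinset.card)]
    simp [hsum]
  rw [hprod, indepPoly]
  symm
  refine Finset.sum_bij (fun f _ => Finset.univ.filter fun p : Fin m × Fin n => f p.1 = some p.2)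
    ?_ ?_ ?_ ?_
  · intro f _
    refine Finset.mem_filter.2 ⟨Finset.mem_univ _, ?_⟩
    rintro ⟨i, u⟩ hu ⟨j, v⟩ hv ⟨hij, hne⟩
    simp only [Finset.mem_filter, Finset.mem_univ, true_and] at hu hv hij
    subst hij
    simp_all
  · intro f _ g _ hfg
    funext i
    refine Option.ext fun u => ?_
    have := Finset.ext_iff.1 hfg (i, u)
    simpa using this
  · intro s hs
    have hs := (Finset.mem_filter.1 hs).2
    refine ⟨fun i => if h : ∃ u, (i, u) ∈ s then some h.choose else none,
      Finset.mem_univ _, ?_⟩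
    ext ⟨i, u⟩
    simp only [Finset.mem_filter, Finset.mem_univ, true_and]
    constructor
    · intro h
      split_ifs at h with hex
      have := hex.choose_spec
      rwa [Option.some.inj h] at this
    · intro hu
      have hex : ∃ u, (i, u) ∈ s := ⟨u, hu⟩
      rw [dif_pos hex]
      by_contra hne
      exact hs _ hex.choose_spec _ hu ⟨rfl, fun h => hne (congrArg some (Prod.ext_iff.1 h).2)⟩
  · intro f _
    rw [Finset.prod_pow_eq_pow_sum]
    congr 1
    rw [Finset.card_filter, Fintype.sum_prod_type]
    refine Finset.sum_congr rfl fun i _ => ?_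
    rw [← Finset.card_filter]
    congr 1
    ext u
    simp

theorem indepPoly_Gabcd (a b c d : ℕ) :
    indepPoly (Gabcd a b c d) = (1 + (a : ℂ[X]) * X) ^ 4 + (1 + (b : ℂ[X]) * X) ^ 3
      + (1 + (c : ℂ[X]) * X) ^ 2 + (1 + (d : ℂ[X]) * X) - 3 := by
  have h₁ := indepPoly_graphJoin (mClique 2 c) (SimpleGraph.completeGraph (Fin d))
  have h₂ := indepPoly_graphJoin (mClique 3 b)
    (graphJoin (mClique 2 c) (SimpleGraph.completeGraph (Fin d)))
  have h₃ := indepPoly_graphJoin (mClique 4 a) (graphJoin (mClique 3 b)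
    (graphJoin (mClique 2 c) (SimpleGraph.completeGraph (Fin d))))
  rw [indepPoly_mClique] at h₁ h₂ h₃
  rw [indepPoly_completeGraph] at h₁
  rw [Gabcd]
  linear_combination h₁ + h₂ + h₃

/-- A square root `z` of `-1` is an independence root of `G(a,b,c,d)` as soon as the real and
imaginary parts of the independence polynomial at `i` vanish. -/
theorem eval_indepPoly_Gabcd_eq_zero {a b c d : ℤ} (ha : 0 ≤ a) (hb : 0 ≤ b) (hc : 0 ≤ c)
    (hd : 0 ≤ d) (hre : a ^ 4 - 6 * a ^ 2 - 3 * b ^ 2 - c ^ 2 + 1 = 0)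
    (him : 4 * a - 4 * a ^ 3 + 3 * b - b ^ 3 + 2 * c + d = 0) {z : ℂ} (hz : z ^ 2 = -1) :
    (indepPoly (Gabcd a.toNat b.toNat c.toNat d.toNat)).eval z = 0 := by
  lift a to ℕ using ha
  lift b to ℕ using hb
  lift c to ℕ using hc
  lift d to ℕ using hd
  have hre' : (a : ℂ) ^ 4 - 6 * a ^ 2 - 3 * b ^ 2 - c ^ 2 + 1 = 0 := by exact_mod_cast hre
  have him' : 4 * (a : ℂ) - 4 * a ^ 3 + 3 * b - b ^ 3 + 2 * c + d = 0 := by exact_mod_cast him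
  have hz3 : z ^ 3 = -z := by linear_combination z * hz
  have hz4 : z ^ 4 = 1 := by linear_combination (z ^ 2 - 1) * hz
  simp only [Int.toNat_natCast, indepPoly_Gabcd, eval_sub, eval_add, eval_pow, eval_mul,
    eval_one, eval_natCast, eval_X, eval_ofNat]
  linear_combination hre' + z * him' + (6 * (a : ℂ) ^ 2 + 3 * b ^ 2 + c ^ 2) * hz
    + (4 * (a : ℂ) ^ 3 + b ^ 3) * hz3 + (a : ℂ) ^ 4 * hz4

theorem pell_recurrence_invariant {x y : ℕ → ℤ}
    (hx1 : x 1 = 1) (hy1 : y 1 = 1) (hx2 : x 2 = 5) (hy2 : y 2 = 3)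
    (hx : ∀ n, 3 ≤ n → x n = 4 * x (n - 1) - x (n - 2))
    (hy : ∀ n, 3 ≤ n → y n = 4 * y (n - 1) - y (n - 2)) {n : ℕ} (hn : 1 ≤ n) :
    0 < x n ∧ 0 < y n ∧ x n ^ 2 = 3 * y n ^ 2 - 2 ∧
      x (n + 1) = 2 * x n + 3 * y n ∧ y (n + 1) = x n + 2 * y n := by
  induction n, hn using Nat.le_induction with
  | base => simp [hx1, hy1, hx2, hy2]
  | succ n hn ih =>
    obtain ⟨hxpos, hypos, hxy, hxs, hys⟩ := ih
    have hx' : x (n + 1 + 1) = 4 * x (n + 1) - x n := hx (n + 2) (by omega)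
    have hy' : y (n + 1 + 1) = 4 * y (n + 1) - y n := hy (n + 2) (by omega)
    refine ⟨by omega, by omega, ?_, by omega, by omega⟩
    rw [hxs, hys]
    linear_combination hxy

/-- With `a = 3yₙ`, `b = 3yₙxₙ`, `c = 1`, `d = 4a³ − 4a + b³ − 3b − 2`, the quantities
`a, b, c, d` are positive integers and `G(a,b,c,d)` has independence roots at `i` and `−i`. -/
theorem Gabcd_has_root_I (x y : ℕ → ℤ)
    (hx1 : x 1 = 1) (hy1 : y 1 = 1) (hx2 : x 2 = 5) (hy2 : y 2 = 3)
    (hx : ∀ n, 3 ≤ n → x n = 4 * x (n - 1) - x (n - 2))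
    (hy : ∀ n, 3 ≤ n → y n = 4 * y (n - 1) - y (n - 2)) :
    ∀ n, 1 ≤ n → ∀ a b c d : ℤ,
      a = 3 * y n → b = 3 * y n * x n → c = 1 → d = 4 * a ^ 3 - 4 * a + b ^ 3 - 3 * b - 2 →
      0 < a ∧ 0 < b ∧ 0 < c ∧ 0 < d ∧
      (indepPoly (Gabcd a.toNat b.toNat c.toNat d.toNat)).eval Complex.I = 0 ∧
      (indepPoly (Gabcd a.toNat b.toNat c.toNat d.toNat)).eval (-Complex.I) = 0 := by
  intro n hn a b c d ha hb hc hd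
  obtain ⟨hxpos, hypos, hxy, -, -⟩ := pell_recurrence_invariant hx1 hy1 hx2 hy2 hx hy hn
  have ha3 : 3 ≤ a := by omega
  have hb3 : 3 ≤ b := by rw [hb]; nlinarith
  have hc0 : 0 < c := by omega
  have hd0 : 0 < d := by
    have h₁ : 0 < a * (a ^ 2 - 1) := mul_pos (by omega) (by nlinarith)
    have h₂ : 3 * 6 ≤ b * (b ^ 2 - 3) := mul_le_mul hb3 (by nlinarith) (by norm_num) (by omega)
    rw [hd]
    linarith
  have hre : a ^ 4 - 6 * a ^ 2 - 3 * b ^ 2 - c ^ 2 + 1 = 0 := by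
    rw [ha, hb, hc]
    linear_combination -27 * y n ^ 2 * hxy
  have him : 4 * a - 4 * a ^ 3 + 3 * b - b ^ 3 + 2 * c + d = 0 := by
    rw [hd, hc]
    ring
  have hroot {z : ℂ} (hz : z ^ 2 = -1) :=
    eval_indepPoly_Gabcd_eq_zero (by omega) (by omega) hc0.le hd0.le hre him hz
  exact ⟨by omega, by omega, hc0, hd0, hroot Complex.I_sq, hroot (by simp)⟩
end

section
/- Let n be a positive integer. If a finite simple graph G has independence roots at i and −i, then the lexicographic product G[K_n] has independence roots at i/n and −i/n. -/
open scoped Classical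
open Polynomial

/-- Independent sets of `G[Kₙ]` are exactly the sets whose projection to `G` is injective
with independent image. -/
theorem lexProd_completeGraph_isIndepFinset_iff {V : Type} (G : SimpleGraph V) (n : ℕ)
    (s : Finset (V × Fin n)) :
    (lexProd G (SimpleGraph.completeGraph (Fin n))).IsIndepFinset s ↔
      G.IsIndepFinset (s.image Prod.fst) ∧ Set.InjOn Prod.fst (s : Set (V × Fin n)) := by
  constructor
  · intro h
    refine ⟨?_, ?_⟩
    · intro u hu v hv huv
      obtain ⟨x, hx, rfl⟩ := Finset.mem_image.1 hu
      obtain ⟨y, hy, rfl⟩ := Finset.mem_image.1 hv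
      exact h x hx y hy (Or.inl huv)
    · intro x hx y hy hxy
      by_contra hne
      exact h x hx y hy (Or.inr ⟨hxy, fun h2 => hne (Prod.ext hxy h2)⟩)
  · rintro ⟨hG, hinj⟩ x hx y hy (hxy | ⟨h1, h2⟩)
    · exact hG _ (Finset.mem_image_of_mem _ hx) _ (Finset.mem_image_of_mem _ hy) hxy
    · exact h2 (congrArg Prod.snd (hinj hx hy h1))

/-- The number of partial sections of `V × Fin n → V` with domain `t` is `n ^ #t`. -/
theorem card_filter_injOn_fst_image_eq {V : Type} [Fintype V] (n : ℕ) (t : Finset V) :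
    (Finset.univ.filter (fun s : Finset (V × Fin n) =>
      Set.InjOn Prod.fst (s : Set (V × Fin n)) ∧ s.image Prod.fst = t)).card = n ^ t.card := by
  have hcard : (Finset.univ : Finset (t → Fin n)).card = n ^ t.card := by simp
  rw [← hcard]
  symm
  refine Finset.card_bij
    (fun f _ => Finset.univ.image (fun v : t => ((v : V), f v))) ?_ ?_ ?_
  · intro f _
    simp only [Finset.mem_filter, Finset.mem_univ, true_and]
    refine ⟨?_, ?_⟩
    · intro x hx y hy hxy
      simp only [Finset.coe_image, Finset.coe_univ, Set.image_univ, Set.mem_range] at hx hy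
      obtain ⟨v, rfl⟩ := hx
      obtain ⟨w, rfl⟩ := hy
      rw [Subtype.ext hxy]
    · ext v
      simp
  · intro f _ g _ hfg
    funext v
    have hv : ((v : V), f v) ∈ Finset.univ.image (fun v : t => ((v : V), g v)) :=
      hfg ▸ Finset.mem_image_of_mem (fun v : t => ((v : V), f v)) (Finset.mem_univ v)
    obtain ⟨w, -, hw⟩ := Finset.mem_image.1 hv
    obtain ⟨h1, h2⟩ := Prod.mk.inj hw
    rw [← h2, Subtype.ext h1]
  · intro s hs
    simp only [Finset.mem_filter, Finset.mem_univ, true_and] at hs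
    obtain ⟨hinj, rfl⟩ := hs
    have hex : ∀ v : s.image Prod.fst, ∃ u, ((v : V), u) ∈ s := by
      rintro ⟨v, hv⟩
      obtain ⟨x, hx, rfl⟩ := Finset.mem_image.1 hv
      exact ⟨x.2, hx⟩
    choose f hf using hex
    refine ⟨f, Finset.mem_univ _, ?_⟩
    ext x
    simp only [Finset.mem_image, Finset.mem_univ, true_and]
    constructor
    · rintro ⟨v, rfl⟩
      exact hf v
    · intro hx
      exact ⟨⟨x.1, Finset.mem_image_of_mem _ hx⟩, hinj (hf _) hx rfl⟩

/-- `I(G[Kₙ], x) = I(G, n x)`. -/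
theorem indepPoly_lexProd_completeGraph_eval {V : Type} [Fintype V] (G : SimpleGraph V)
    (n : ℕ) (x : ℂ) :
    (indepPoly (lexProd G (SimpleGraph.completeGraph (Fin n)))).eval x =
      (indepPoly G).eval (n * x) := by
  simp only [indepPoly, eval_finsetSum, eval_pow, eval_X]
  rw [← Finset.sum_fiberwise_of_maps_to (g := fun s => s.image Prod.fst)
    (t := Finset.univ.filter (fun t : Finset V => G.IsIndepFinset t))]
  · refine Finset.sum_congr rfl fun t ht => ?_
    have hset : (Finset.univ.filter (fun s : Finset (V × Fin n) =>
          (lexProd G (SimpleGraph.completeGraph (Fin n))).IsIndepFinset s)).filter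
          (fun s => s.image Prod.fst = t) =
        Finset.univ.filter (fun s : Finset (V × Fin n) =>
          Set.InjOn Prod.fst (s : Set (V × Fin n)) ∧ s.image Prod.fst = t) := by
      ext s
      simp only [Finset.mem_filter, Finset.mem_univ, true_and,
        lexProd_completeGraph_isIndepFinset_iff] at ht ⊢
      constructor
      · rintro ⟨⟨-, h⟩, rfl⟩
        exact ⟨h, rfl⟩
      · rintro ⟨h, rfl⟩
        exact ⟨⟨ht, h⟩, rfl⟩
    rw [hset, Finset.sum_congr rfl (g := fun _ => x ^ t.card), Finset.sum_const,
      card_filter_injOn_fst_image_eq, nsmul_eq_mul, mul_pow, Nat.cast_pow]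
    intro s hs
    obtain ⟨-, hinj, rfl⟩ := Finset.mem_filter.1 hs
    rw [Finset.card_image_of_injOn hinj]
  · intro s hs
    simp only [Finset.mem_filter, Finset.mem_univ, true_and,
      lexProd_completeGraph_isIndepFinset_iff] at hs ⊢
    exact hs.1

/-- If `G` has independence roots at `i` and `−i`, then the lexicographic product `G[Kₙ]`
has independence roots at `i/n` and `−i/n`. -/
theorem lexProd_complete_has_root_I_div_n {V : Type} [Fintype V] (G : SimpleGraph V)
    (n : ℕ) (hn : 0 < n)
    (h1 : (indepPoly G).eval Complex.I = 0) (h2 : (indepPoly G).eval (-Complex.I) = 0) :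
    (indepPoly (lexProd G (SimpleGraph.completeGraph (Fin n)))).eval (Complex.I / n) = 0 ∧
    (indepPoly (lexProd G (SimpleGraph.completeGraph (Fin n)))).eval (-(Complex.I / n)) = 0 := by
  have hn' : (n : ℂ) ≠ 0 := Nat.cast_ne_zero.2 hn.ne'
  rw [indepPoly_lexProd_completeGraph_eval, indepPoly_lexProd_completeGraph_eval, mul_neg,
    mul_div_cancel₀ _ hn']
  exact ⟨h1, h2⟩
end
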